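/- arXiv:1611.06272 — 4 statements merged into one kernel-verified Lean document; each statement's English description precedes it below -/
import Mathlib

section
/- Let φ : A → B be a surjective *-homomorphism between two C*-algebras, and let (p_n)_{n ∈ ℕ} be a countable family of pairwise commuting projections in B. Then there exists a countable family (q_n)_{n ∈ ℕ} of pairwise commuting positive elements of A (not necessarily projections) such that φ(q_n) = p_n for every n ∈ ℕ. -/
/-- A continuous ramp equal to `0` on `(-∞, 1/3]` and to `1` on `[2/3, ∞)`. -/
noncomputable def ramp (x : ℝ) : ℝ := max 0 (min 1 (3 * x - 1))

lemma continuous_ramp : Continuous ramp := by unfold ramp; fun_prop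

lemma ramp_nonneg (x : ℝ) : 0 ≤ ramp x := le_max_left _ _

lemma ramp_of_le {x : ℝ} (hx : x ≤ 1 / 3) : ramp x = 0 :=
  max_eq_left (min_le_of_right_le (by linarith))

lemma ramp_of_ge {x : ℝ} (hx : 2 / 3 ≤ x) : ramp x = 1 := by
  rw [ramp, min_eq_left (by linarith), max_eq_right zero_le_one]

lemma ramp_zero : ramp 0 = 0 := ramp_of_le (by norm_num)

/-- The shift on base-four expansions with digits `0` and `1`. -/
noncomputable def digitShift (x : ℝ) : ℝ := 4 * (x - ramp x)

lemma continuous_digitShift : Continuous digitShift := by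
  have := continuous_ramp
  unfold digitShift
  fun_prop

lemma digitShift_zero : digitShift 0 = 0 := by simp [digitShift, ramp_zero]

lemma digitShift_iterate_zero (n : ℕ) : digitShift^[n] 0 = 0 :=
  Function.iterate_fixed digitShift_zero n

section CStarAlgebra

variable {A : Type*} [NonUnitalCStarAlgebra A]

/-- The leading digit `p` of `p + s / 4` is recovered by `ramp`. -/
lemma cfcₙ_ramp_add_smul {p s : A} (hp : IsSelfAdjoint p) (hpp : p * p = p)
    (hs : IsSelfAdjoint s) (hps : Commute p s) (hn : ‖s‖ ≤ 4 / 3) :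
    cfcₙ ramp (p + (4⁻¹ : ℝ) • s) = p := by
  set z : A := p + Complex.I • s with hz
  have hre : (realPart z : A) = p := by
    simp [hz, hp.coe_realPart, hs.imaginaryPart]
  have him : (imaginaryPart z : A) = s := by
    simp [hz, hs.coe_realPart, hp.imaginaryPart]
  have hzn : IsStarNormal z := by
    refine ⟨?_⟩
    simp only [hz, star_add, star_smul, hp.star_eq, hs.star_eq, Commute, SemiconjBy, mul_add,
      add_mul, smul_mul_assoc, mul_smul_comm, hps.eq]
    simp
  have hp' : cfcₙ (fun x : ℂ ↦ (x.re : ℂ)) z = p := by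
    rw [cfcₙ_comp_re (fun x ↦ x) z, hre, cfcₙ_id' ℝ p]
  have hs' : cfcₙ (fun x : ℂ ↦ (x.im : ℂ)) z = s := by
    rw [cfcₙ_comp_im (fun x ↦ x) z, him, cfcₙ_id' ℝ s]
  have hr : cfcₙ (fun x : ℂ ↦ ((x.re + 4⁻¹ * x.im : ℝ) : ℂ)) z = p + (4⁻¹ : ℝ) • s := by
    conv_rhs => rw [← hp', ← hs', ← cfcₙ_smul (4⁻¹ : ℝ) _ z, ← cfcₙ_add _ _ z]
    simp
  have hsa : IsSelfAdjoint (p + (4⁻¹ : ℝ) • s) := hp.add (.smul (.all _) hs)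
  have hcr := continuous_ramp
  rw [cfcₙ_real_eq_complex ramp hsa, ← hr,
    ← cfcₙ_comp' (fun x : ℂ ↦ (ramp x.re : ℂ)) _ z
      (by fun_prop) (by simp [ramp_zero]) (by fun_prop) (by simp) hzn]
  conv_rhs => rw [← hp']
  refine cfcₙ_congr fun x hx ↦ ?_
  have h1 : (x.re : ℂ) ∈ quasispectrum ℂ p := by
    rw [← hp', cfcₙ_map_quasispectrum _ z (by fun_prop) rfl hzn]
    exact ⟨x, hx, rfl⟩
  have h2 : |x.im| ≤ 4 / 3 := by
    have := norm_apply_le_norm_cfcₙ (fun x : ℂ ↦ (x.im : ℂ)) z hx (by fun_prop) rfl hzn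
    rw [hs'] at this
    simpa using this.trans hn
  have h3 := IsIdempotentElem.quasispectrum_subset ℂ hpp h1
  rw [abs_le] at h2
  simp only [Set.mem_insert_iff, Set.mem_singleton_iff, Complex.ofReal_eq_zero,
    Complex.ofReal_eq_one] at h3
  simp only [Complex.ofReal_re, Complex.ofReal_inj]
  rcases h3 with h | h
  · rw [h, ramp_of_le (by linarith)]
  · rw [h, ramp_of_ge (by linarith)]

/-- Commuting projections are jointly encoded as the base-four digits of one self-adjoint
element. -/
lemma exists_isSelfAdjoint_cfcₙ_ramp_eq (p : ℕ → A) (hsa : ∀ n, IsSelfAdjoint (p n))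
    (hidem : ∀ n, p n * p n = p n) (hcomm : ∀ m n, p m * p n = p n * p m) :
    ∃ b : A, IsSelfAdjoint b ∧ ∀ n, cfcₙ (ramp ∘ digitShift^[n]) b = p n := by
  let r (k : ℕ) : A := ∑' n, (4⁻¹ : ℝ) ^ n • p (n + k)
  have hgeom : HasSum (fun n : ℕ ↦ (4⁻¹ : ℝ) ^ n) (4 / 3) := by
    convert! hasSum_geometric_of_lt_one (r := (4⁻¹ : ℝ)) (by norm_num) (by norm_num) using 1
    norm_num
  have hbound (k n : ℕ) : ‖(4⁻¹ : ℝ) ^ n • p (n + k)‖ ≤ (4⁻¹ : ℝ) ^ n := by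
    rw [norm_smul, Real.norm_of_nonneg (by positivity)]
    exact mul_le_of_le_one_right (by positivity)
      (IsStarProjection.norm_le _ ⟨hidem _, hsa _⟩)
  have hsum (k : ℕ) : Summable fun n ↦ (4⁻¹ : ℝ) ^ n • p (n + k) :=
    .of_norm_bounded hgeom.summable (hbound k)
  have hr_norm (k : ℕ) : ‖r k‖ ≤ 4 / 3 := tsum_of_norm_bounded hgeom (hbound k)
  have hr_sa (k : ℕ) : IsSelfAdjoint (r k) := by
    simp only [r, IsSelfAdjoint, tsum_star, star_smul, (hsa _).star_eq, star_trivial]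
  have hr_comm (m k : ℕ) : Commute (p m) (r k) := by
    simp only [r, Commute, SemiconjBy]
    rw [← (hsum k).tsum_mul_left, ← (hsum k).tsum_mul_right]
    simp only [mul_smul_comm, smul_mul_assoc, hcomm m]
  have hr_succ (k : ℕ) : r k = p k + (4⁻¹ : ℝ) • r (k + 1) := by
    simp only [r]
    rw [(hsum k).tsum_eq_zero_add, ← (hsum (k + 1)).tsum_const_smul]
    simp only [pow_zero, one_smul, zero_add, smul_smul, pow_succ', add_assoc, add_comm 1]
  have hramp (k : ℕ) : cfcₙ ramp (r k) = p k := by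
    rw [hr_succ]
    exact cfcₙ_ramp_add_smul (hsa k) (hidem k) (hr_sa _) (hr_comm _ _) (hr_norm _)
  have hcr := continuous_ramp
  have hcd := continuous_digitShift
  have hshift (k : ℕ) : cfcₙ digitShift (r k) = r (k + 1) := by
    unfold digitShift
    rw [cfcₙ_const_mul (4 : ℝ) (fun x ↦ x - ramp x) (r k) (by fun_prop) (by simp [ramp_zero]),
      cfcₙ_sub (fun x ↦ x) ramp (r k) (by fun_prop) rfl (by fun_prop) ramp_zero,
      cfcₙ_id' ℝ (r k) (hr_sa k), hramp, hr_succ k]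
    simp [smul_smul]
  have hiter (k : ℕ) : cfcₙ digitShift^[k] (r 0) = r k := by
    induction k with
    | zero => exact cfcₙ_id ℝ (r 0) (hr_sa 0)
    | succ k ih =>
      rw [Function.iterate_succ', cfcₙ_comp digitShift digitShift^[k] (r 0)
        hcd.continuousOn digitShift_zero (hcd.iterate k).continuousOn
        (digitShift_iterate_zero k) (hr_sa 0), ih, hshift]
  refine ⟨r 0, hr_sa 0, fun n ↦ ?_⟩
  rw [cfcₙ_comp ramp digitShift^[n] (r 0) hcr.continuousOn ramp_zero
    (hcd.iterate n).continuousOn (digitShift_iterate_zero n) (hr_sa 0), hiter, hramp]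

/-- Nonnegative functions give elements of the form `star c * c`. -/
lemma exists_cfcₙ_eq_star_mul_self {f : ℝ → ℝ} (hf : Continuous f) (hf0 : f 0 = 0)
    (hf_nonneg : ∀ x, 0 ≤ f x) (a : A) : ∃ c : A, cfcₙ f a = star c * c := by
  refine ⟨cfcₙ (fun x ↦ √(f x)) a, ?_⟩
  rw [← cfcₙ_star, ← cfcₙ_mul _ _ a (by fun_prop) (by simp [hf0]) (by fun_prop) (by simp [hf0])]
  simp [Real.mul_self_sqrt (hf_nonneg _)]

end CStarAlgebra

/-- Any countable family of pairwise commuting projections in the image of a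
surjective *-homomorphism of C*-algebras lifts to a countable family of pairwise commuting
positive elements. -/
theorem stmt_2 {A B : Type*} [NonUnitalCStarAlgebra A] [NonUnitalCStarAlgebra B]
    (φ : A →⋆ₙₐ[ℂ] B) (hφ : Function.Surjective φ)
    (p : ℕ → B) (hsa : ∀ n, IsSelfAdjoint (p n)) (hidem : ∀ n, p n * p n = p n)
    (hcomm : ∀ m n, p m * p n = p n * p m) :
    ∃ q : ℕ → A, (∀ n, ∃ c : A, q n = star c * c) ∧
      (∀ m n, q m * q n = q n * q m) ∧ (∀ n, φ (q n) = p n) := by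
  obtain ⟨b, hb, hbp⟩ := exists_isSelfAdjoint_cfcₙ_ramp_eq p hsa hidem hcomm
  obtain ⟨a, rfl⟩ := hφ b
  have hφc : Continuous φ :=
    AddMonoidHomClass.continuous_of_bound φ 1 fun x ↦ by
      simpa using NonUnitalStarAlgHom.norm_apply_le φ x
  have hre : φ (realPart a : A) = φ a := by
    rw [realPart_apply_coe, ← Complex.coe_smul, map_smul, map_add, map_star, hb.star_eq,
      Complex.coe_smul, ← two_smul ℝ, smul_smul]
    simp
  have hcont (n : ℕ) : Continuous (ramp ∘ digitShift^[n]) :=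
    continuous_ramp.comp (continuous_digitShift.iterate n)
  have hzero (n : ℕ) : (ramp ∘ digitShift^[n]) 0 = 0 := by
    simp [digitShift_iterate_zero, ramp_zero]
  refine ⟨fun n ↦ cfcₙ (ramp ∘ digitShift^[n]) (realPart a : A), fun n ↦ ?_, fun m n ↦ ?_,
    fun n ↦ ?_⟩
  · exact exists_cfcₙ_eq_star_mul_self (hcont n) (hzero n) (fun _ ↦ ramp_nonneg _) _
  · exact cfcₙ_commute_cfcₙ _ _ _
  · rw [← hbp n, ← hre]
    exact NonUnitalStarAlgHomClass.map_cfcₙ (S := ℂ) φ _ _ (hcont n).continuousOn (hzero n)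
      hφc (realPart a).2 ((realPart a).2.map φ)
end

section
/- Let φ : A → B be a surjective *-homomorphism between two C*-algebras, and let (b_n)_{n ∈ ℕ} be a countable family of pairwise orthogonal positive elements of B. Then there exists a countable family (a_n)_{n ∈ ℕ} of pairwise orthogonal positive elements of A such that φ(a_n) = b_n for every n ∈ ℕ. -/
open scoped NNReal

section OrthogonalLifting

theorem mul_eq_zero_of_mul_mul_self_eq_zero {A : Type*} [NonUnitalCStarAlgebra A] {z s : A}
    (hs : IsSelfAdjoint s) (h : z * s * s = 0) : z * s = 0 := by
  rw [← CStarRing.mul_star_self_eq_zero_iff, star_mul, hs.star_eq, ← mul_assoc, h, zero_mul]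

theorem mul_eq_zero_of_mul_cube_eq_zero {A : Type*} [NonUnitalCStarAlgebra A] {z s : A}
    (hs : IsSelfAdjoint s) (h : z * (s * s * s) = 0) : z * s = 0 :=
  mul_eq_zero_of_mul_mul_self_eq_zero hs <|
    mul_eq_zero_of_mul_mul_self_eq_zero hs <| by simpa only [mul_assoc] using h

theorem mul_eq_zero_comm_of_isSelfAdjoint {A : Type*} [NonUnitalCStarAlgebra A] {a b : A}
    (ha : IsSelfAdjoint a) (hb : IsSelfAdjoint b) (h : a * b = 0) : b * a = 0 := by
  simpa [ha.star_eq, hb.star_eq] using congr(star $h)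

variable {A B : Type*} [NonUnitalCStarAlgebra A] [PartialOrder A] [StarOrderedRing A]
  [NonUnitalCStarAlgebra B] [PartialOrder B] [StarOrderedRing B]

theorem exists_nonneg_cube_eq {a : A} (ha : 0 ≤ a) : ∃ s : A, 0 ≤ s ∧ s * s * s = a :=
  ⟨a ^ (3⁻¹ : ℝ≥0), CFC.nnrpow_nonneg, by
    rw [← CFC.nnrpow_three _ CFC.nnrpow_nonneg, CFC.nnrpow_inv_nnrpow a three_ne_zero ha]⟩

theorem eq_of_cube_eq_cube {s t : A} (hs : 0 ≤ s) (ht : 0 ≤ t)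
    (h : s * s * s = t * t * t) : s = t := by
  rw [← CFC.nnrpow_three s hs, ← CFC.nnrpow_three t ht] at h
  rw [← CFC.nnrpow_nnrpow_inv s three_ne_zero hs, h, CFC.nnrpow_nnrpow_inv t three_ne_zero ht]

theorem cube_nonneg_of_nonneg {s : A} (hs : 0 ≤ s) : 0 ≤ s * s * s := by
  rw [← CFC.nnrpow_three s hs]
  exact CFC.nnrpow_nonneg

theorem map_nonneg_of_nonneg (φ : A →⋆ₙₐ[ℂ] B) {a : A} (ha : 0 ≤ a) : 0 ≤ φ a := by
  obtain ⟨c, rfl⟩ := CStarAlgebra.nonneg_iff_eq_star_mul_self.mp ha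
  rw [map_mul, map_star]
  exact star_mul_self_nonneg _

theorem exists_nonneg_lift {φ : A →⋆ₙₐ[ℂ] B} (hφ : Function.Surjective φ) {b : B} (hb : 0 ≤ b) :
    ∃ a, 0 ≤ a ∧ φ a = b := by
  obtain ⟨c, rfl⟩ := CStarAlgebra.nonneg_iff_eq_star_mul_self.mp hb
  obtain ⟨d, rfl⟩ := hφ c
  exact ⟨star d * d, star_mul_self_nonneg _, by rw [map_mul, map_star]⟩

/-- Given a positive lift `g` of a sum `c + h` of orthogonal positive elements, the cube of `c`
and the element `h` lift to orthogonal positive elements annihilated by the annihilator of `g`. -/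
theorem exists_orthogonal_lift_of_add {φ : A →⋆ₙₐ[ℂ] B} (hφ : Function.Surjective φ)
    {c h : B} (hc : 0 ≤ c) (hh : 0 ≤ h) (hch : c * h = 0) {g : A} (hg : 0 ≤ g)
    (hgφ : φ g = c + h) :
    ∃ a r : A, 0 ≤ a ∧ 0 ≤ r ∧ φ a = c * c * c ∧ φ r = h ∧ a * r = 0 ∧
      ∀ z, z * g = 0 → z * a = 0 ∧ z * r = 0 := by
  obtain ⟨u, hu, rfl⟩ := exists_nonneg_lift hφ hc
  obtain ⟨v, hv, rfl⟩ := exists_nonneg_lift hφ hh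
  have hhc : φ v * φ u = 0 := mul_eq_zero_comm_of_isSelfAdjoint hc.isSelfAdjoint
    hh.isSelfAdjoint hch
  set x := g * (u - v) * g with hx
  have hxs : IsSelfAdjoint x := by
    simp [hx, IsSelfAdjoint, hg.isSelfAdjoint.star_eq, hu.isSelfAdjoint.star_eq,
      hv.isSelfAdjoint.star_eq, mul_assoc]
  have hxd := CFC.posPart_sub_negPart x hxs
  have hφx : φ x = φ u * φ u * φ u - φ v * φ v * φ v := by
    simp only [hx, map_mul, map_sub, hgφ, add_mul, mul_add, sub_mul, mul_sub, hch, hhc, mul_assoc]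
    simp [hch, ← mul_assoc, hhc]
  have hφd : φ x = φ x⁺ - φ x⁻ := by rw [← map_sub, hxd]
  have hortho : φ u * φ u * φ u * (φ v * φ v * φ v) = 0 := by
    simp only [mul_assoc]
    simp only [← mul_assoc (φ u) (φ v), hch, zero_mul, mul_zero]
  obtain ⟨h1, h2⟩ := CFC.posPart_negPart_unique hφx hortho
    (cube_nonneg_of_nonneg hc) (cube_nonneg_of_nonneg hh)
  obtain ⟨h3, h4⟩ := CFC.posPart_negPart_unique hφd
    (by rw [← map_mul, CFC.posPart_mul_negPart, map_zero])
    (map_nonneg_of_nonneg φ (CFC.posPart_nonneg x))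
    (map_nonneg_of_nonneg φ (CFC.negPart_nonneg x))
  obtain ⟨r, hr, hrx⟩ := exists_nonneg_cube_eq (CFC.negPart_nonneg x)
  refine ⟨x⁺, r, CFC.posPart_nonneg x, hr, h3.symm.trans h1, ?_, ?_, fun z hz ↦ ?_⟩
  · refine eq_of_cube_eq_cube (map_nonneg_of_nonneg φ hr) hh ?_
    rw [← map_mul, ← map_mul, hrx]
    exact h4.symm.trans h2
  · apply mul_eq_zero_of_mul_cube_eq_zero hr.isSelfAdjoint
    rw [hrx, CFC.posPart_mul_negPart]
  · have hzx : z * x⁺ = z * x⁻ := by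
      rw [← sub_eq_zero, ← mul_sub, hxd, hx, ← mul_assoc, ← mul_assoc, hz, zero_mul, zero_mul]
    have hzp : z * x⁺ = 0 := by
      apply mul_eq_zero_of_mul_mul_self_eq_zero (CFC.posPart_nonneg x).isSelfAdjoint
      rw [hzx, mul_assoc, CFC.negPart_mul_posPart, mul_zero]
    refine ⟨hzp, mul_eq_zero_of_mul_cube_eq_zero hr.isSelfAdjoint ?_⟩
    rw [hrx, ← hzx, hzp]

/-- The cubes of a summable orthogonal sequence of positive elements lift to an orthogonal
sequence of positive elements. -/
theorem exists_orthogonal_lift_of_summable {φ : A →⋆ₙₐ[ℂ] B} (hφ : Function.Surjective φ)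
    {c : ℕ → B} (hc : ∀ n, 0 ≤ c n) (hsum : Summable c)
    (horth : ∀ m n, m ≠ n → c m * c n = 0) :
    ∃ a : ℕ → A, (∀ n, 0 ≤ a n) ∧ (∀ m n, m ≠ n → a m * a n = 0) ∧
      ∀ n, φ (a n) = c n * c n * c n := by
  let H : ℕ → B := fun n ↦ ∑' k, c (k + n)
  have hs n : Summable fun k ↦ c (k + n) := (summable_nat_add_iff n).mpr hsum
  have hH n : 0 ≤ H n := tsum_nonneg fun k ↦ hc _
  have hadd n : H n = c n + H (n + 1) := by
    simp only [H]
    rw [(hs n).tsum_eq_zero_add, zero_add]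
    simp only [add_assoc, add_comm 1 n]
  have hcH n : c n * H (n + 1) = 0 := by
    rw [← (hs (n + 1)).tsum_mul_left]
    exact (tsum_congr fun k ↦ horth n (k + (n + 1)) (by omega)).trans tsum_zero
  have step : ∀ n (g : {g : A // 0 ≤ g ∧ φ g = H n}), ∃ p : A × {r : A // 0 ≤ r ∧ φ r = H (n + 1)},
      0 ≤ p.1 ∧ φ p.1 = c n * c n * c n ∧ p.1 * p.2 = 0 ∧
        ∀ z, z * (g : A) = 0 → z * p.1 = 0 ∧ z * p.2 = 0 := by
    rintro n ⟨g, hg, hgφ⟩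
    obtain ⟨a, r, ha, hr, hφa, hφr, har, hz⟩ :=
      exists_orthogonal_lift_of_add hφ (hc n) (hH (n + 1)) (hcH n) hg (hgφ.trans (hadd n))
    exact ⟨⟨a, r, hr, hφr⟩, ha, hφa, har, hz⟩
  choose p hp hpφ hpo hpz using step
  obtain ⟨g₀, hg₀⟩ := exists_nonneg_lift hφ (hH 0)
  let g : ∀ n, {g : A // 0 ≤ g ∧ φ g = H n} := fun n ↦
    Nat.rec ⟨g₀, hg₀⟩ (fun n r ↦ (p n r).2) n
  let a : ℕ → A := fun n ↦ (p n (g n)).1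
  have hag (m k : ℕ) : a m * (g (m + 1 + k)).1 = 0 := by
    induction k with
    | zero => exact hpo m (g m)
    | succ k ih => exact (hpz _ _ _ ih).2
  have hlt (m n : ℕ) (hmn : m < n) : a m * a n = 0 := by
    obtain ⟨k, rfl⟩ := Nat.exists_eq_add_of_le (Nat.succ_le_of_lt hmn)
    exact (hpz _ _ _ (hag m k)).1
  refine ⟨a, fun n ↦ hp n _, fun m n hmn ↦ ?_, fun n ↦ hpφ n _⟩
  obtain h | h := hmn.lt_or_gt
  · exact hlt m n h
  · exact mul_eq_zero_comm_of_isSelfAdjoint (hp _ _).isSelfAdjoint (hp _ _).isSelfAdjoint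
      (hlt n m h)

theorem exists_orthogonal_lift {φ : A →⋆ₙₐ[ℂ] B} (hφ : Function.Surjective φ)
    {b : ℕ → B} (hb : ∀ n, 0 ≤ b n) (horth : ∀ m n, m ≠ n → b m * b n = 0) :
    ∃ a : ℕ → A, (∀ n, 0 ≤ a n) ∧ (∀ m n, m ≠ n → a m * a n = 0) ∧ ∀ n, φ (a n) = b n := by
  choose c hc hcb using fun n ↦ exists_nonneg_cube_eq (hb n)
  have hco m n (hmn : m ≠ n) : c m * c n = 0 := by
    apply mul_eq_zero_of_mul_cube_eq_zero (hc n).isSelfAdjoint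
    rw [hcb]
    apply mul_eq_zero_comm_of_isSelfAdjoint (hb n).isSelfAdjoint (hc m).isSelfAdjoint
    apply mul_eq_zero_of_mul_cube_eq_zero (hc m).isSelfAdjoint
    rw [hcb, horth n m hmn.symm]
  let δ : ℕ → ℝ := fun n ↦ (1 / 2) ^ n / (1 + ‖c n‖)
  have hδ n : 0 < δ n := by positivity
  have hsum : Summable fun n ↦ δ n • c n := by
    refine Summable.of_norm_bounded summable_geometric_two fun n ↦ ?_
    rw [norm_smul, Real.norm_of_nonneg (hδ n).le, div_mul_eq_mul_div, div_le_iff₀ (by positivity)]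
    gcongr
    linarith
  obtain ⟨a, ha, hao, hφa⟩ := exists_orthogonal_lift_of_summable hφ
    (fun n ↦ smul_nonneg (hδ n).le (hc n)) hsum fun m n hmn ↦ by
      rw [smul_mul_smul_comm, hco m n hmn, smul_zero]
  refine ⟨fun n ↦ ((δ n) ^ 3)⁻¹ • a n, fun n ↦ smul_nonneg (by have := hδ n; positivity) (ha n),
    fun m n hmn ↦ by rw [smul_mul_smul_comm, hao m n hmn, smul_zero], fun n ↦ ?_⟩
  have h3 : δ n ^ 3 ≠ 0 := pow_ne_zero _ (hδ n).ne'
  dsimp only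
  rw [← Complex.coe_smul, map_smul, Complex.coe_smul, hφa, smul_mul_smul_comm, smul_mul_smul_comm,
    hcb, smul_smul, ← pow_three', inv_mul_cancel₀ h3, one_smul]

end OrthogonalLifting

/-- Any countable family of pairwise orthogonal positive elements in the image of a
surjective *-homomorphism of C*-algebras lifts to a countable family of pairwise orthogonal
positive elements. -/
theorem stmt_3 {A B : Type*} [NonUnitalCStarAlgebra A] [NonUnitalCStarAlgebra B]
    (φ : A →⋆ₙₐ[ℂ] B) (hφ : Function.Surjective φ)
    (b : ℕ → B) (hpos : ∀ n, ∃ c : B, b n = star c * c)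
    (horth : ∀ m n, m ≠ n → b m * b n = 0) :
    ∃ a : ℕ → A, (∀ n, ∃ c : A, a n = star c * c) ∧
      (∀ m n, m ≠ n → a m * a n = 0) ∧ (∀ n, φ (a n) = b n) := by
  let _ := CStarAlgebra.spectralOrder A
  let _ := CStarAlgebra.spectralOrder B
  have := CStarAlgebra.spectralOrderedRing A
  have := CStarAlgebra.spectralOrderedRing B
  obtain ⟨a, ha, hao, hφa⟩ := exists_orthogonal_lift hφ
    (fun n ↦ CStarAlgebra.nonneg_iff_eq_star_mul_self.mpr (hpos n)) horth
  exact ⟨a, fun n ↦ CStarAlgebra.nonneg_iff_eq_star_mul_self.mp (ha n), hao, hφa⟩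
end

section
/- Let A be a non-unital C*-algebra with an approximate unit (e_n)_{n ∈ ℕ} satisfying e_i e_j = e_i for all i < j, let f : ℕ → ℕ be strictly increasing, and let (c_k)_{k ∈ ℕ} be positive elements of A satisfying (e_{f(2k+1)} − e_{f(2k)}) c_k = c_k = c_k (e_{f(2k+1)} − e_{f(2k)}) for every k and sup_k ‖c_k‖ = M < ∞. Then the elements c_k are pairwise orthogonal, the partial sums Σ_{k < K} c_k converge in the strict topology (i.e., for every x ∈ A, the sequences (Σ_{k < K} c_k)·x and x·(Σ_{k < K} c_k) converge in norm) to a positive element a of M(A), and ‖a‖ ≤ M. -/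
open scoped MultiplierAlgebra

universe u

/-- A sequence `e : ℕ → A` is an approximate unit: positive elements of norm at most one with
`‖e n * a - a‖ → 0` and `‖a * e n - a‖ → 0` for every `a`. -/
def IsApproximateUnit (A : Type u) [NonUnitalCStarAlgebra A] (e : ℕ → A) : Prop :=
  (∀ n, (∃ c : A, e n = star c * c) ∧ ‖e n‖ ≤ 1) ∧
    ∀ a : A, Filter.Tendsto (fun n => ‖e n * a - a‖) Filter.atTop (nhds 0) ∧
      Filter.Tendsto (fun n => ‖a * e n - a‖) Filter.atTop (nhds 0)

/-- A C⋆-algebra is non-unital if it has no multiplicative unit. -/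
def IsNonUnital (A : Type u) [NonUnitalCStarAlgebra A] : Prop :=
  ¬∃ u : A, ∀ a : A, u * a = a ∧ a * u = a

open Filter Topology
open scoped Function

namespace DoubleCentralizer

variable {A : Type u} [NonUnitalCStarAlgebra A]

lemma mul_coe_eq_coe_fst (a : 𝓜(ℂ, A)) (x : A) :
    a * (x : 𝓜(ℂ, A)) = (a.fst x : A) := by
  refine DoubleCentralizer.ext _ _ _ _ <| Prod.ext ?_ ?_ <;> ext y
  · change a.fst (x * y) = a.fst x * y
    rw [← sub_eq_zero, ← CStarRing.star_mul_self_eq_zero_iff]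
    set z := star (a.fst (x * y) - a.fst x * y)
    rw [mul_sub, ← a.central, ← mul_assoc z, ← a.central, mul_assoc, sub_self]
  · exact a.central y x

lemma coe_mul_eq_coe_snd (a : 𝓜(ℂ, A)) (x : A) :
    (x : 𝓜(ℂ, A)) * a = (a.snd x : A) := by
  apply star_injective
  have h (y : A) : star (y : 𝓜(ℂ, A)) = (star y : A) := (map_star (coeHom (𝕜 := ℂ)) y).symm
  rw [star_mul, h, h, mul_coe_eq_coe_fst, star_fst, star_star]

/-- A sequence of multipliers coming from `A` whose left and right products with every element
converge has a strict limit. -/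
lemma exists_tendsto_fst_snd {T : ℕ → A}
    (hl : ∀ x, ∃ y, Tendsto (fun n => T n * x) atTop (𝓝 y))
    (hr : ∀ x, ∃ y, Tendsto (fun n => x * T n) atTop (𝓝 y)) :
    ∃ a : 𝓜(ℂ, A), ∀ x, Tendsto (fun n => T n * x) atTop (𝓝 (a.fst x)) ∧
      Tendsto (fun n => x * T n) atTop (𝓝 (a.snd x)) := by
  choose L hL using hl
  choose R hR using hr
  let L' : A →L[ℂ] A := continuousLinearMapOfTendsto
    (fun n => ContinuousLinearMap.mul ℂ A (T n)) (f := L) (tendsto_pi_nhds.2 hL)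
  let R' : A →L[ℂ] A := continuousLinearMapOfTendsto
    (fun n => (ContinuousLinearMap.mul ℂ A).flip (T n)) (f := R) (tendsto_pi_nhds.2 hR)
  refine ⟨⟨(L', R'), fun x y => ?_⟩, fun x => ⟨hL x, hR x⟩⟩
  refine tendsto_nhds_unique ((hR x).mul_const y) ?_
  simp only [mul_assoc]
  exact (hL y).const_mul x

end DoubleCentralizer

section

variable {A : Type u} [NonUnitalCStarAlgebra A] {e : ℕ → A}

lemma IsApproximateUnit.isSelfAdjoint (he : IsApproximateUnit A e) (n : ℕ) :
    IsSelfAdjoint (e n) := by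
  obtain ⟨c, hc⟩ := (he.1 n).1
  exact hc ▸ IsSelfAdjoint.star_mul_self c

lemma IsApproximateUnit.mul_eq_of_lt (he : IsApproximateUnit A e)
    (hord : ∀ i j, i < j → e i * e j = e i) {i j : ℕ} (h : i < j) : e j * e i = e i := by
  simpa [(he.isSelfAdjoint _).star_eq] using congrArg star (hord i j h)

/-- A bounded sequence whose products with each member of an approximate unit are eventually
constant converges pointwise as a sequence of left multiplications. -/
lemma IsApproximateUnit.exists_tendsto_mul (he : IsApproximateUnit A e) {T : ℕ → A} {C : ℝ}
    (hC : ∀ n, ‖T n‖ ≤ C) (hT : ∀ m, ∃ N, ∀ n ≥ N, T n * e m = T N * e m) (x : A) :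
    ∃ y, Tendsto (fun n => T n * x) atTop (𝓝 y) := by
  have hC0 : 0 ≤ C := (norm_nonneg _).trans (hC 0)
  refine cauchySeq_tendsto_of_complete (Metric.cauchySeq_iff'.2 fun ε hε => ?_)
  obtain ⟨m, hm⟩ := ((he.2 x).1.eventually_lt_const
    (show 0 < ε / (2 * C + 1) by positivity)).exists
  obtain ⟨N, hN⟩ := hT m
  refine ⟨N, fun n hn => ?_⟩
  have key : T n * x - T N * x = T N * (e m * x - x) - T n * (e m * x - x) := by
    simp only [mul_sub, ← mul_assoc, hN n hn]
    abel
  rw [lt_div_iff₀ (by positivity)] at hm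
  calc dist (T n * x) (T N * x) = ‖T N * (e m * x - x) - T n * (e m * x - x)‖ := by
        rw [dist_eq_norm, key]
    _ ≤ C * ‖e m * x - x‖ + C * ‖e m * x - x‖ :=
        (norm_sub_le _ _).trans <| add_le_add (norm_mul_le_of_le (hC _) le_rfl)
          (norm_mul_le_of_le (hC _) le_rfl)
    _ ≤ ‖e m * x - x‖ * (2 * C + 1) := by nlinarith [norm_nonneg (e m * x - x)]
    _ < ε := hm

lemma exists_isSelfAdjoint_mul_self_eq {c : A} (hc : ∃ x, c = star x * x) :
    ∃ b : A, IsSelfAdjoint b ∧ b * b = c := by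
  let _ := CStarAlgebra.spectralOrder A
  have := CStarAlgebra.spectralOrderedRing A
  obtain ⟨x, rfl⟩ := hc
  exact ⟨CFC.sqrt (star x * x), (CFC.sqrt_nonneg _).isSelfAdjoint,
    CFC.sqrt_mul_sqrt_self _ (star_mul_self_nonneg x)⟩

lemma IsSelfAdjoint.mul_eq_self_of_mul_mul_self {b p : A} (hb : IsSelfAdjoint b)
    (h : p * (b * b) = b * b) : p * b = b := by
  have h' : b * (b * star p) = b * b := by
    simpa [hb.star_eq, mul_assoc] using congrArg star h
  rw [← sub_eq_zero, ← CStarRing.mul_star_self_eq_zero_iff]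
  simp only [star_sub, star_mul, hb.star_eq, mul_sub, sub_mul, mul_assoc, h, h', sub_self]

lemma norm_sum_le_of_orthogonal {b : ℕ → A} {C : ℝ} (hC : ∀ k, ‖b k‖ ≤ C)
    (hb : ∀ k, IsSelfAdjoint (b k)) (h0 : Pairwise ((· * · = 0) on b)) (s : Finset ℕ) :
    ‖∑ k ∈ s, b k‖ ≤ C := by
  lift C to NNReal using (norm_nonneg _).trans (hC 0)
  rw [← coe_nnnorm, NNReal.coe_le_coe, IsSelfAdjoint.nnnorm_sum_eq_sup s (fun k _ => hb k) h0]
  exact Finset.sup_le fun k _ => hC k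

lemma sum_mul_sum_of_orthogonal {b : ℕ → A} (h0 : Pairwise ((· * · = 0) on b)) (s : Finset ℕ) :
    (∑ k ∈ s, b k) * ∑ k ∈ s, b k = ∑ k ∈ s, b k * b k := by
  rw [Finset.sum_mul_sum]
  exact Finset.sum_congr rfl fun i hi =>
    Finset.sum_eq_single_of_mem i hi fun j _ hj => h0 hj.symm

variable {f : ℕ → ℕ}

lemma pairwise_mul_eq_zero_of_support (he : IsApproximateUnit A e)
    (hord : ∀ i j, i < j → e i * e j = e i) (hf : StrictMono f) {c : ℕ → A}
    (hl : ∀ k, (e (f (2 * k + 1)) - e (f (2 * k))) * c k = c k)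
    (hr : ∀ k, c k * (e (f (2 * k + 1)) - e (f (2 * k))) = c k) :
    Pairwise ((· * · = 0) on c) := by
  have key {k l : ℕ}
      (h : (e (f (2 * k + 1)) - e (f (2 * k))) * (e (f (2 * l + 1)) - e (f (2 * l))) = 0) :
      c k * c l = 0 := by
    rw [← hr k, ← hl l, mul_assoc, ← mul_assoc _ _ (c l), h, zero_mul, mul_zero]
  intro k l hkl
  rcases hkl.lt_or_gt with h | h
  · apply key
    simp only [mul_sub, sub_mul]
    rw [hord _ _ (hf (by lia : 2 * k + 1 < 2 * l + 1)), hord _ _ (hf (by lia : 2 * k < 2 * l + 1)),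
      hord _ _ (hf (by lia : 2 * k + 1 < 2 * l)), hord _ _ (hf (by lia : 2 * k < 2 * l)), sub_self]
  · apply key
    simp only [mul_sub, sub_mul]
    rw [he.mul_eq_of_lt hord (hf (by lia : 2 * l + 1 < 2 * k + 1)),
      he.mul_eq_of_lt hord (hf (by lia : 2 * l < 2 * k + 1)),
      he.mul_eq_of_lt hord (hf (by lia : 2 * l + 1 < 2 * k)),
      he.mul_eq_of_lt hord (hf (by lia : 2 * l < 2 * k))]
    simp

lemma sum_mul_eq_of_support (he : IsApproximateUnit A e)
    (hord : ∀ i j, i < j → e i * e j = e i) (hf : StrictMono f) {b : ℕ → A}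
    (hr : ∀ k, b k * (e (f (2 * k + 1)) - e (f (2 * k))) = b k) {m n : ℕ} (hn : m + 1 ≤ n) :
    (∑ k ∈ Finset.range n, b k) * e m = (∑ k ∈ Finset.range (m + 1), b k) * e m := by
  simp only [Finset.sum_mul]
  refine (Finset.sum_subset (Finset.range_mono hn) fun k _ hk => ?_).symm
  have hk : m < k := by simpa using hk
  have h1 : m < f (2 * k) := by have := hf.le_apply (x := 2 * k); lia
  rw [← hr k, mul_assoc, sub_mul, he.mul_eq_of_lt hord h1,
    he.mul_eq_of_lt hord (h1.trans (hf (Nat.lt_succ_self _))), sub_self, mul_zero]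

end

/-- Let `A` be non-unital with approximate unit `(e n)` satisfying `e i * e j = e i`
for `i < j`, let `f : ℕ → ℕ` be strictly increasing, and let `(c k)` be positive elements with
`(e (f (2k+1)) - e (f (2k))) * c k = c k = c k * (e (f (2k+1)) - e (f (2k)))` and
`sup_k ‖c k‖ = M < ∞`. Then the `c k` are pairwise orthogonal, and the partial sums `∑_{k<K} c k`
converge in the strict topology (tested against every `x ∈ A` on both sides) to a positive
element `a` of `𝓜(ℂ, A)` with `‖a‖ ≤ M`. -/
theorem stmt_8 {A : Type u} [NonUnitalCStarAlgebra A]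
    (hnu : IsNonUnital A)
    (e : ℕ → A) (he : IsApproximateUnit A e) (hord : ∀ i j, i < j → e i * e j = e i)
    (f : ℕ → ℕ) (hf : StrictMono f)
    (c : ℕ → A) (hpos : ∀ k, ∃ x : A, c k = star x * x)
    (hsupp : ∀ k, (e (f (2 * k + 1)) - e (f (2 * k))) * c k = c k ∧
      c k * (e (f (2 * k + 1)) - e (f (2 * k))) = c k)
    (M : ℝ) (hM : IsLUB (Set.range fun k => ‖c k‖) M) :
    (∀ k l, k ≠ l → c k * c l = 0) ∧
    ∃ a : 𝓜(ℂ, A), (∃ x : 𝓜(ℂ, A), a = star x * x) ∧ ‖a‖ ≤ M ∧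
      ∀ x : A,
        Filter.Tendsto
          (fun K : ℕ => (∑ k ∈ Finset.range K, (c k : 𝓜(ℂ, A))) * (x : 𝓜(ℂ, A)))
          Filter.atTop (nhds (a * (x : 𝓜(ℂ, A)))) ∧
        Filter.Tendsto
          (fun K : ℕ => (x : 𝓜(ℂ, A)) * ∑ k ∈ Finset.range K, (c k : 𝓜(ℂ, A)))
          Filter.atTop (nhds ((x : 𝓜(ℂ, A)) * a)) := by
  choose b hb hbc using fun k => exists_isSelfAdjoint_mul_self_eq (hpos k)
  have hbl (k : ℕ) : (e (f (2 * k + 1)) - e (f (2 * k))) * b k = b k :=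
    (hb k).mul_eq_self_of_mul_mul_self (by rw [hbc, (hsupp k).1])
  have hbr (k : ℕ) : b k * (e (f (2 * k + 1)) - e (f (2 * k))) = b k := by
    simpa [(hb k).star_eq, (he.isSelfAdjoint _).star_eq] using congrArg star (hbl k)
  have hc0 := pairwise_mul_eq_zero_of_support he hord hf (fun k => (hsupp k).1)
    fun k => (hsupp k).2
  have hb0 := pairwise_mul_eq_zero_of_support he hord hf hbl hbr
  refine ⟨fun k l h => hc0 h, ?_⟩
  have hcM (k : ℕ) : ‖c k‖ ≤ M := hM.1 ⟨k, rfl⟩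
  have hM0 : 0 ≤ M := (norm_nonneg _).trans (hcM 0)
  have hbM (k : ℕ) : ‖b k‖ ≤ √M :=
    Real.le_sqrt_of_sq_le (by rw [← (hb k).norm_mul_self, hbc]; exact hcM k)
  have hcM' := norm_sum_le_of_orthogonal hcM (fun k => by
    obtain ⟨x, hx⟩ := hpos k
    exact hx ▸ IsSelfAdjoint.star_mul_self x) hc0
  set T : ℕ → A := fun n => ∑ k ∈ Finset.range n, b k with hT
  have hTsa (n : ℕ) : star (T n) = T n := by simp [hT, (hb _).star_eq]
  have hTM (n : ℕ) : ‖T n‖ ≤ √M := norm_sum_le_of_orthogonal hbM hb hb0 _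
  have hTT (n : ℕ) : T n * T n = ∑ k ∈ Finset.range n, c k := by
    simp only [hT, sum_mul_sum_of_orthogonal hb0, hbc]
  have hl := he.exists_tendsto_mul hTM
    fun m => ⟨m + 1, fun n hn => sum_mul_eq_of_support he hord hf hbr hn⟩
  obtain ⟨β, hβ⟩ := DoubleCentralizer.exists_tendsto_fst_snd hl fun x => by
    obtain ⟨y, hy⟩ := hl (star x)
    exact ⟨star y, by simpa [hTsa] using hy.star⟩
  have hβsa : star β = β := by
    refine DoubleCentralizer.ext _ _ _ _ <| Prod.ext ?_ ?_ <;> ext x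
    · refine tendsto_nhds_unique ?_ (hβ x).1
      simpa [hTsa] using (hβ (star x)).2.star
    · refine tendsto_nhds_unique ?_ (hβ x).2
      simpa [hTsa] using (hβ (star x)).1.star
  have hfst (x : A) : Tendsto (fun n => (∑ k ∈ Finset.range n, c k) * x) atTop
      (𝓝 ((star β * β).fst x)) := by
    have h1 : Tendsto (fun n => T n * (T n * x - β.fst x)) atTop (𝓝 0) := by
      refine squeeze_zero_norm (fun n => norm_mul_le_of_le (hTM n) le_rfl) ?_
      simpa using ((hβ x).1.sub_const (β.fst x)).norm.const_mul (√M)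
    have h2 := h1.add (hβ (β.fst x)).1
    simpa [hβsa, mul_sub, ← mul_assoc, hTT] using h2
  have hsnd (x : A) : Tendsto (fun n => x * ∑ k ∈ Finset.range n, c k) atTop
      (𝓝 ((star β * β).snd x)) := by
    have h := (hfst (star x)).star
    rw [← DoubleCentralizer.star_snd, (IsSelfAdjoint.star_mul_self β).star_eq] at h
    simpa [← hTT, hTsa] using h
  have hcoe : Continuous (fun x : A => (x : 𝓜(ℂ, A))) :=
    AddMonoidHomClass.continuous_of_bound (DoubleCentralizer.coeHom (𝕜 := ℂ) (A := A)) 1 fun x => by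
      rw [one_mul, ← DoubleCentralizer.norm_fst]
      exact ContinuousLinearMap.opNorm_mul_apply_le ℂ A x
  have hsum (n : ℕ) : (∑ k ∈ Finset.range n, (c k : 𝓜(ℂ, A))) =
      ((∑ k ∈ Finset.range n, c k : A) : 𝓜(ℂ, A)) :=
    (map_sum (DoubleCentralizer.coeHom (𝕜 := ℂ) (A := A)) _ _).symm
  refine ⟨star β * β, ⟨β, rfl⟩, ?_, fun x => ⟨?_, ?_⟩⟩
  · rw [← DoubleCentralizer.norm_fst]
    exact ContinuousLinearMap.opNorm_le_bound _ hM0 fun x => le_of_tendsto' (hfst x).norm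
      fun n => norm_mul_le_of_le (hcM' _) le_rfl
  · simp only [hsum, DoubleCentralizer.mul_coe_eq_coe_fst]
    exact (hcoe.tendsto _).comp (hfst x)
  · simp only [hsum, DoubleCentralizer.coe_mul_eq_coe_snd]
    exact (hcoe.tendsto _).comp (hsnd x)
end

section
/- Let A be a non-unital C*-algebra with an approximate unit (e_n)_{n ∈ ℕ} satisfying e_i e_j = e_i for all i < j, let f, g : ℕ → ℕ be strictly increasing, and let (c_k)_{k ∈ ℕ} and (c'_l)_{l ∈ ℕ} be bounded sequences of positive elements of A with (e_{f(2k+1)} − e_{f(2k)}) c_k = c_k = c_k (e_{f(2k+1)} − e_{f(2k)}) and (e_{g(2l+1)} − e_{g(2l)}) c'_l = c'_l = c'_l (e_{g(2l+1)} − e_{g(2l)}) for all k, l. Let a, a' ∈ M(A) be the strict limits of the partial sums of Σ_k c_k and Σ_l c'_l respectively. If (e_{f(2k+1)} − e_{f(2k)})(e_{g(2l+1)} − e_{g(2l)}) = 0 for all but finitely many pairs (k, l), then the product a a' belongs to A. -/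
open scoped MultiplierAlgebra

universe u

/-- The canonical image of `A` inside its multiplier algebra `𝓜(ℂ, A)`. -/
noncomputable def coronaKernel (A : Type u) [NonUnitalCStarAlgebra A] : Set 𝓜(ℂ, A) :=
  Set.range (fun a : A => (a : 𝓜(ℂ, A)))

namespace DoubleCentralizer

variable {A : Type u} [NonUnitalCStarAlgebra A]

theorem ext_of_snd {m n : 𝓜(ℂ, A)} (h : ∀ y, m.snd y = n.snd y) : m = n := by
  rw [← sub_eq_zero, ← norm_eq_zero, ← norm_snd, norm_eq_zero]
  ext y
  simp [h y]

/-- The algebra `A` is a left ideal in its multiplier algebra. -/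
theorem mul_coe_eq (m : 𝓜(ℂ, A)) (x : A) :
    m * (x : 𝓜(ℂ, A)) = (m.fst x : 𝓜(ℂ, A)) :=
  ext_of_snd fun y => by simpa using m.central y x

/-- The algebra `A` is essential in its multiplier algebra. -/
theorem ext_of_mul_coe {m n : 𝓜(ℂ, A)}
    (h : ∀ x : A, m * (x : 𝓜(ℂ, A)) = n * (x : 𝓜(ℂ, A))) : m = n := by
  refine ext_of_snd fun y => ?_
  rw [← sub_eq_zero, ← CStarRing.mul_star_self_eq_zero_iff]
  have hy := congrArg (fun b : 𝓜(ℂ, A) => b.snd y) (h (star (m.snd y - n.snd y)))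
  simp only [mul_snd, coe_snd, ContinuousLinearMap.mul_apply', mul_apply_eq_comp,
    ContinuousLinearMap.flip_apply] at hy
  rw [sub_mul, sub_eq_zero]
  exact hy

/-- Multiplication of left strict limits, when the product of the sequences is eventually
constant. -/
theorem mul_eq_of_tendsto_strict {s t : ℕ → 𝓜(ℂ, A)} {a b S : 𝓜(ℂ, A)} {N : ℕ}
    (hs : ∀ x : A, Filter.Tendsto (fun K => s K * (x : 𝓜(ℂ, A))) Filter.atTop
      (nhds (a * (x : 𝓜(ℂ, A)))))
    (ht : ∀ x : A, Filter.Tendsto (fun L => t L * (x : 𝓜(ℂ, A))) Filter.atTop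
      (nhds (b * (x : 𝓜(ℂ, A)))))
    (hst : ∀ K, N ≤ K → ∀ L, N ≤ L → s K * t L = S) : a * b = S := by
  refine ext_of_mul_coe fun x => ?_
  have hK : ∀ K, N ≤ K → s K * (b * (x : 𝓜(ℂ, A))) = S * (x : 𝓜(ℂ, A)) := fun K hK =>
    tendsto_nhds_unique ((ht x).const_mul (s K)) <| tendsto_const_nhds.congr' <| by
      filter_upwards [Filter.eventually_ge_atTop N] with L hL
      rw [← mul_assoc, hst K hK L hL]
  have h := hs (b.fst x)
  rw [← mul_coe_eq] at h
  rw [mul_assoc]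
  refine tendsto_nhds_unique h <| tendsto_const_nhds.congr' ?_
  filter_upwards [Filter.eventually_ge_atTop N] with K h_ge
  exact (hK K h_ge).symm

end DoubleCentralizer

/-- Let `A` be non-unital with approximate unit `(e n)` satisfying `e i * e j = e i`
for `i < j`, let `f, g : ℕ → ℕ` be strictly increasing, and let `(c k)`, `(c' l)` be bounded
sequences of positive elements supported in `e (f (2k+1)) - e (f (2k))`, resp.
`e (g (2l+1)) - e (g (2l))`. Let `a, a' ∈ 𝓜(ℂ, A)` be the strict limits of the partial sums of
`∑ c k` and `∑ c' l`. If `(e (f (2k+1)) - e (f (2k))) * (e (g (2l+1)) - e (g (2l))) = 0` for all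
but finitely many pairs `(k, l)`, then `a * a'` belongs to `A`. -/
theorem stmt_9 {A : Type u} [NonUnitalCStarAlgebra A]
    (hnu : IsNonUnital A)
    (e : ℕ → A) (he : IsApproximateUnit A e) (hord : ∀ i j, i < j → e i * e j = e i)
    (f g : ℕ → ℕ) (hf : StrictMono f) (hg : StrictMono g)
    (c c' : ℕ → A)
    (hpos : ∀ k, ∃ x : A, c k = star x * x) (hpos' : ∀ l, ∃ x : A, c' l = star x * x)
    (hbdd : ∃ M : ℝ, ∀ k, ‖c k‖ ≤ M) (hbdd' : ∃ M : ℝ, ∀ l, ‖c' l‖ ≤ M)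
    (hsupp : ∀ k, (e (f (2 * k + 1)) - e (f (2 * k))) * c k = c k ∧
      c k * (e (f (2 * k + 1)) - e (f (2 * k))) = c k)
    (hsupp' : ∀ l, (e (g (2 * l + 1)) - e (g (2 * l))) * c' l = c' l ∧
      c' l * (e (g (2 * l + 1)) - e (g (2 * l))) = c' l)
    (a a' : 𝓜(ℂ, A))
    (ha : ∀ x : A,
      Filter.Tendsto (fun K : ℕ => (∑ k ∈ Finset.range K, (c k : 𝓜(ℂ, A))) * (x : 𝓜(ℂ, A)))
        Filter.atTop (nhds (a * (x : 𝓜(ℂ, A)))) ∧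
      Filter.Tendsto (fun K : ℕ => (x : 𝓜(ℂ, A)) * ∑ k ∈ Finset.range K, (c k : 𝓜(ℂ, A)))
        Filter.atTop (nhds ((x : 𝓜(ℂ, A)) * a)))
    (ha' : ∀ x : A,
      Filter.Tendsto (fun L : ℕ => (∑ l ∈ Finset.range L, (c' l : 𝓜(ℂ, A))) * (x : 𝓜(ℂ, A)))
        Filter.atTop (nhds (a' * (x : 𝓜(ℂ, A)))) ∧
      Filter.Tendsto (fun L : ℕ => (x : 𝓜(ℂ, A)) * ∑ l ∈ Finset.range L, (c' l : 𝓜(ℂ, A)))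
        Filter.atTop (nhds ((x : 𝓜(ℂ, A)) * a')))
    (hdisj : {p : ℕ × ℕ |
      (e (f (2 * p.1 + 1)) - e (f (2 * p.1))) * (e (g (2 * p.2 + 1)) - e (g (2 * p.2))) ≠ 0}.Finite) :
    a * a' ∈ coronaKernel A := by
  have hzero : ∀ k l, (k, l) ∉ hdisj.toFinset → c k * c' l = 0 := fun k l hkl => by
    rw [Set.Finite.mem_toFinset, Set.mem_ofPred_eq, not_not] at hkl
    rw [← (hsupp k).2, ← (hsupp' l).1, mul_assoc, ← mul_assoc _ _ (c' l), hkl, zero_mul,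
      mul_zero]
  obtain ⟨N, hN⟩ : ∃ N, ∀ p ∈ hdisj.toFinset, p.1 < N ∧ p.2 < N :=
    ⟨hdisj.toFinset.sup (fun p => max p.1 p.2) + 1, fun p hp => by
      have := Finset.le_sup (f := fun p : ℕ × ℕ => max p.1 p.2) hp
      omega⟩
  have hcoe : ∀ K, ∀ d : ℕ → A, ∑ k ∈ Finset.range K, (d k : 𝓜(ℂ, A)) =
      ((∑ k ∈ Finset.range K, d k : A) : 𝓜(ℂ, A)) := fun K d =>
    (map_sum (DoubleCentralizer.coeHom (𝕜 := ℂ) (A := A)) d (Finset.range K)).symm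
  refine ⟨∑ p ∈ hdisj.toFinset, c p.1 * c' p.2,
    (DoubleCentralizer.mul_eq_of_tendsto_strict (N := N) (fun x => (ha x).1) (fun x => (ha' x).1)
      fun K hK L hL => ?_).symm⟩
  rw [hcoe, hcoe]
  refine (map_mul (DoubleCentralizer.coeHom (𝕜 := ℂ) (A := A)) _ _).symm.trans
    (congrArg (DoubleCentralizer.coe ℂ) ?_)
  rw [Finset.sum_mul_sum, ← Finset.sum_product']
  refine (Finset.sum_subset (fun p hp => ?_) fun p _ hp => hzero p.1 p.2 hp).symm
  have := hN p hp
  simp only [Finset.mem_product, Finset.mem_range]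
  omega
end
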